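/- Fix 1 ≤ p ≤ ∞, 0 < δ < 1, integers 1 ≤ m < n with δ = (m−1)/n, and let t*_p(δ;n) be the unique solution of δ = D_p(t) − (t/2)D_p'(t), where D_p(t;n) = (1/n)[E_{h∼N(0,I_n)} dist(h, {x : ‖x‖_{p*} ≤ t})]². Let θ(t) = E_{h∼N(0,1)}(|h| − t)₊². Then: (i) for any n ≥ 1, t*_p(δ;n) ≤ 2·θ⁻¹(δ)·n^{1−1/p}; and (ii) for any n ≥ 2/(1−δ), t*_p(δ;n) ≥ θ⁻¹((1+δ)/2) > 0. -/

import Mathlib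

open MeasureTheory ProbabilityTheory Filter
open scoped ENNReal NNReal

/-- The standard Gaussian measure `N(0, I_n)` on `ℝ^n`. -/
noncomputable def stdGaussian (n : ℕ) : Measure (Fin n → ℝ) :=
  Measure.pi fun _ => gaussianReal 0 1

/-- The Euclidean (`ℓ²`) norm on `ℝ^n`. -/
noncomputable def l2norm {n : ℕ} (x : Fin n → ℝ) : ℝ := Real.sqrt (∑ i, x i ^ 2)

/-- The `ℓ^q` norm on `ℝ^n` for an extended exponent `q ∈ [1, ∞]`. -/
noncomputable def lqNorm {n : ℕ} (q : ℝ≥0∞) (x : Fin n → ℝ) : ℝ :=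
  if q = ⊤ then ⨆ i, |x i| else (∑ i, |x i| ^ q.toReal) ^ (1 / q.toReal)

/-- Euclidean distance from `h ∈ ℝ^n` to a set `C ⊆ ℝ^n`. -/
noncomputable def distL2 {n : ℕ} (C : Set (Fin n → ℝ)) (h : Fin n → ℝ) : ℝ :=
  sInf ((fun w => l2norm (h - w)) '' C)

/-- `D_p(t; n) = (1/n) (E_{h ∼ N(0,I_n)} dist(h, {x : ‖x‖_{p*} ≤ t}))²`, expressed in terms
of the Hölder conjugate exponent `q = p*`. -/
noncomputable def Dp (q : ℝ≥0∞) (n : ℕ) (t : ℝ) : ℝ :=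
  (1 / n) * (∫ h, distL2 {x | lqNorm q x ≤ t} h ∂stdGaussian n) ^ 2


/-- `θ(t) = E (|h| − t)₊²` for `h ∼ N(0, 1)`. -/
noncomputable def thetaFun (t : ℝ) : ℝ :=
  ∫ x, max (|x| - t) 0 ^ 2 ∂gaussianReal 0 1


theorem integrable_gaussianReal_iff {f : ℝ → ℝ} :
    Integrable f (gaussianReal 0 1) ↔ Integrable fun x => gaussianPDFReal 0 1 x * f x := by
  rw [gaussianReal_of_var_ne_zero _ one_ne_zero,
    integrable_withDensity_iff_integrable_smul' (measurable_gaussianPDF 0 1)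
      (ae_of_all _ fun _ => gaussianPDF_lt_top)]
  simp [toReal_gaussianPDF]

theorem hasDerivAt_gaussianPDFReal (x : ℝ) :
    HasDerivAt (gaussianPDFReal 0 1) (-x * gaussianPDFReal 0 1 x) x := by
  have h : HasDerivAt (fun y : ℝ => -(y - 0) ^ 2 / (2 * ((1 : ℝ≥0) : ℝ))) (-x) x := by
    refine ((((hasDerivAt_id x).sub_const 0).pow 2).neg.div_const
      (2 * ((1 : ℝ≥0) : ℝ))).congr_deriv ?_
    simp only [id, NNReal.coe_one]
    ring
  refine (h.exp.const_mul (√(2 * Real.pi * ((1 : ℝ≥0) : ℝ)))⁻¹).congr_deriv ?_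
  rw [gaussianPDFReal]
  ring

theorem integrable_id_gaussianReal : Integrable (fun x => x) (gaussianReal 0 1) :=
  (memLp_id_gaussianReal 1).integrable le_rfl

theorem integrable_sq_gaussianReal : Integrable (fun x => x ^ 2) (gaussianReal 0 1) :=
  (memLp_id_gaussianReal 2).integrable_sq

theorem integral_mul_gaussianReal {M M' : ℝ → ℝ} {C : ℝ} (hM : ∀ x, HasDerivAt M (M' x) x)
    (hM'c : Continuous M') (hMC : ∀ x, |M x| ≤ C * |x|) (hM'C : ∀ x, |M' x| ≤ C) :
    Integrable (fun x => x * M x) (gaussianReal 0 1) ∧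
    ∫ x, x * M x ∂gaussianReal 0 1 = ∫ x, M' x ∂gaussianReal 0 1 := by
  have hMcont : Continuous M := continuous_iff_continuousAt.2 fun x => (hM x).continuousAt
  have i1 : Integrable (fun x => x * M x) (gaussianReal 0 1) := by
    refine (integrable_sq_gaussianReal.const_mul C).mono' (by fun_prop) (ae_of_all _ fun x => ?_)
    rw [Real.norm_eq_abs, abs_mul, ← sq_abs]
    nlinarith [hMC x, abs_nonneg x]
  have i2 : Integrable M' (gaussianReal 0 1) :=
    (integrable_const C).mono' (by fun_prop) (ae_of_all _ hM'C)
  have i3 : Integrable M (gaussianReal 0 1) :=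
    (integrable_id_gaussianReal.abs.const_mul C).mono' (by fun_prop) (ae_of_all _ hMC)
  refine ⟨i1, ?_⟩
  have key := integral_eq_zero_of_hasDerivAt_of_integrable
    (fun x => (hasDerivAt_gaussianPDFReal x).mul (hM x))
    ((((integrable_gaussianReal_iff.1 i2).sub (integrable_gaussianReal_iff.1 i1))).congr
      (ae_of_all _ fun x => by simp only [Pi.sub_apply]; ring))
    (integrable_gaussianReal_iff.1 i3)
  rw [integral_gaussianReal_eq_integral_smul one_ne_zero,
    integral_gaussianReal_eq_integral_smul one_ne_zero, eq_comm, ← sub_eq_zero]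
  simp only [smul_eq_mul]
  rw [← integral_sub (integrable_gaussianReal_iff.1 i2) (integrable_gaussianReal_iff.1 i1)]
  refine (integral_congr_ae (ae_of_all _ fun x => ?_)).trans key
  ring

theorem sq_sub_le_mul_integral_deriv_sq {G G' : ℝ → ℝ} (hG : ∀ x, HasDerivAt G (G' x) x)
    (hG' : Continuous G') (x : ℝ) :
    (G x - G 0) ^ 2 ≤ x * ∫ s in (0 : ℝ)..x, G' s ^ 2 := by
  have hd : ∫ s in (0 : ℝ)..x, G' s = G x - G 0 :=
    intervalIntegral.integral_eq_sub_of_hasDerivAt (fun s _ => hG s) (hG'.intervalIntegrable _ _)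
  rcases eq_or_ne x 0 with rfl | hx
  · simp
  set l := (G x - G 0) / x with hl
  have hlx : l * x = G x - G 0 := by rw [hl]; field_simp
  have e : ∫ s in (0 : ℝ)..x, (G' s - l) ^ 2
      = (∫ s in (0 : ℝ)..x, G' s ^ 2) - 2 * l * (G x - G 0) + l ^ 2 * x := by
    have : ∀ s, (G' s - l) ^ 2 = G' s ^ 2 - 2 * l * G' s + l ^ 2 := fun s => by ring
    simp_rw [this]
    rw [intervalIntegral.integral_add, intervalIntegral.integral_sub,
      intervalIntegral.integral_const_mul, hd, intervalIntegral.integral_const, smul_eq_mul]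
    · ring
    all_goals exact Continuous.intervalIntegrable (by fun_prop) _ _
  have hnn : 0 ≤ x * ∫ s in (0 : ℝ)..x, (G' s - l) ^ 2 := by
    rcases le_total 0 x with h | h
    · exact mul_nonneg h (intervalIntegral.integral_nonneg h fun s _ => sq_nonneg _)
    · rw [intervalIntegral.integral_symm]
      have := intervalIntegral.integral_nonneg (μ := volume) h fun s _ => sq_nonneg (G' s - l)
      nlinarith
  rw [e] at hnn
  rw [← hlx] at hnn ⊢
  nlinarith

theorem integral_sq_sub_le_integral_deriv_sq {G G' : ℝ → ℝ} (hG : ∀ x, HasDerivAt G (G' x) x)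
    (hG' : Continuous G') (hb : ∀ x, G' x ^ 2 ≤ 1) :
    ∫ x, (G x - G 0) ^ 2 ∂gaussianReal 0 1 ≤ ∫ x, G' x ^ 2 ∂gaussianReal 0 1 := by
  have hc : Continuous fun s => G' s ^ 2 := hG'.pow 2
  have hb' : ∀ x, |G' x ^ 2| ≤ 1 := fun x => by rw [abs_of_nonneg (sq_nonneg _)]; exact hb x
  obtain ⟨hi, he⟩ := integral_mul_gaussianReal (C := 1)
    (M := fun x => ∫ s in (0 : ℝ)..x, G' s ^ 2)
    (fun x => (hc.integral_hasStrictDerivAt 0 x).hasDerivAt)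
    hc (fun x => by
      simpa using intervalIntegral.norm_integral_le_of_norm_le_const (a := 0) (b := x)
        (fun s _ => (Real.norm_eq_abs _).le.trans (hb' s))) hb'
  rw [← he]
  exact integral_mono_of_nonneg (ae_of_all _ fun _ => sq_nonneg _) hi
    (ae_of_all _ fun x => sq_sub_le_mul_integral_deriv_sq hG hG' x)

theorem hasDerivAt_max_zero_sq (x : ℝ) :
    HasDerivAt (fun y : ℝ => max y 0 ^ 2) (2 * max x 0) x := by
  rcases lt_trichotomy x 0 with h | rfl | h
  · rw [max_eq_right h.le, mul_zero]
    refine (hasDerivAt_const x (0 : ℝ)).congr_of_eventuallyEq ?_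
    filter_upwards [Iio_mem_nhds h] with y hy
    simp [max_eq_right (Set.mem_Iio.1 hy).le]
  · rw [hasDerivAt_iff_isLittleO_nhds_zero]
    simp only [zero_add, max_self, smul_eq_mul, mul_zero, sub_zero]
    have : (fun y : ℝ => max y 0 ^ 2) =O[nhds 0] fun y => y ^ 2 :=
      Asymptotics.isBigO_of_le _ fun y => by
        rw [norm_pow, norm_pow]
        gcongr
        simp only [Real.norm_eq_abs]
        rw [abs_of_nonneg (le_max_right _ _)]
        exact max_le (le_abs_self y) (abs_nonneg y)
    simpa using this.trans_isLittleO (Asymptotics.isLittleO_pow_id one_lt_two)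
  · rw [max_eq_left h.le]
    have := hasDerivAt_pow 2 x
    simp only [Nat.cast_ofNat, Nat.add_one_sub_one, pow_one] at this
    refine this.congr_of_eventuallyEq ?_
    filter_upwards [Ioi_mem_nhds h] with y hy
    simp [max_eq_left (Set.mem_Ioi.1 hy).le]

theorem max_abs_sub_sq {t : ℝ} (ht : 0 ≤ t) (x : ℝ) :
    max (|x| - t) 0 ^ 2 = max (x - t) 0 ^ 2 + max (-x - t) 0 ^ 2 := by
  rcases le_total 0 x with h | h
  · rw [abs_of_nonneg h, max_eq_right (show -x - t ≤ 0 by linarith)]; ring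
  · rw [abs_of_nonpos h, max_eq_right (show x - t ≤ 0 by linarith)]; ring

theorem max_abs_sub_sq' {t : ℝ} (ht : 0 ≤ t) (x : ℝ) :
    max (|x| - t) 0 ^ 2 = (max (x - t) 0 - max (-x - t) 0) ^ 2 := by
  rcases le_total 0 x with h | h
  · rw [abs_of_nonneg h, max_eq_right (show -x - t ≤ 0 by linarith)]; ring
  · rw [abs_of_nonpos h, max_eq_right (show x - t ≤ 0 by linarith)]; ring

theorem integral_sqrt_add_sub_sq_le {t c : ℝ} (ht : 0 ≤ t) (hc : 0 < c) :
    ∫ x, (√(c + max (|x| - t) 0 ^ 2) - √c) ^ 2 ∂gaussianReal 0 1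
      ≤ ∫ x, max (|x| - t) 0 ^ 2 / (c + max (|x| - t) 0 ^ 2) ∂gaussianReal 0 1 := by
  have hpos : ∀ x, 0 < c + max (|x| - t) 0 ^ 2 := fun x => by positivity
  have hd : ∀ x, HasDerivAt (fun x => √(c + max (|x| - t) 0 ^ 2))
      ((max (x - t) 0 - max (-x - t) 0) / √(c + max (|x| - t) 0 ^ 2)) x := by
    intro x
    have h1 := (hasDerivAt_max_zero_sq (x - t)).comp x ((hasDerivAt_id x).sub_const t)
    have h2 := (hasDerivAt_max_zero_sq (-x - t)).comp x ((hasDerivAt_id x).neg.sub_const t)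
    have h3 := ((h1.add h2).const_add c)
    have h4 : HasDerivAt (fun x => c + max (|x| - t) 0 ^ 2)
        (2 * (max (x - t) 0 - max (-x - t) 0)) x := by
      refine (h3.congr_deriv (by ring)).congr_of_eventuallyEq (.of_forall fun y => ?_)
      simp [max_abs_sub_sq ht]
    exact (h4.sqrt (hpos x).ne').congr_deriv (mul_div_mul_left _ _ two_ne_zero)
  have hsq : ∀ x, ((max (x - t) 0 - max (-x - t) 0) / √(c + max (|x| - t) 0 ^ 2)) ^ 2
      = max (|x| - t) 0 ^ 2 / (c + max (|x| - t) 0 ^ 2) := fun x => by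
    rw [div_pow, Real.sq_sqrt (hpos x).le, ← max_abs_sub_sq' ht]
  have := integral_sq_sub_le_integral_deriv_sq hd
    (Continuous.div (by fun_prop) (by fun_prop) fun x => (Real.sqrt_pos.2 (hpos x)).ne')
    (fun x => by
      rw [hsq, div_le_one (hpos x)]
      linarith)
  simp_rw [hsq] at this
  simpa [max_eq_right (neg_nonpos.2 ht)] using this

theorem sq_integral_le_integral_sq {α : Type*} [MeasurableSpace α] {μ : Measure α}
    [IsProbabilityMeasure μ] {f : α → ℝ} (hf : Integrable f μ)
    (hf2 : Integrable (fun x => f x ^ 2) μ) :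
    (∫ x, f x ∂μ) ^ 2 ≤ ∫ x, f x ^ 2 ∂μ :=
  ConvexOn.map_integral_le (g := fun y : ℝ => y ^ 2) (even_two.convexOn_pow) (by fun_prop)
    isClosed_univ (by simp) hf hf2

theorem integral_sq_sub_sq_integral_le {α : Type*} [MeasurableSpace α] {μ : Measure α}
    [IsProbabilityMeasure μ] {f : α → ℝ} (hf : Integrable f μ)
    (hf2 : Integrable (fun x => f x ^ 2) μ) (b : ℝ) :
    ∫ x, f x ^ 2 ∂μ - (∫ x, f x ∂μ) ^ 2 ≤ ∫ x, (f x - b) ^ 2 ∂μ := by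
  have e : ∫ x, (f x - b) ^ 2 ∂μ = ∫ x, f x ^ 2 ∂μ - 2 * b * ∫ x, f x ∂μ + b ^ 2 := by
    have : ∀ x, (f x - b) ^ 2 = f x ^ 2 - 2 * b * f x + b ^ 2 := fun x => by ring
    have hm : Integrable (fun x => 2 * b * f x) μ := hf.const_mul _
    have hs : Integrable (fun x => f x ^ 2 - 2 * b * f x) μ := hf2.sub hm
    simp_rw [this]
    rw [integral_add hs (integrable_const _), integral_sub hf2 hm, integral_const_mul]
    simp
  rw [e]
  nlinarith [sq_nonneg (∫ x, f x ∂μ - b)]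

theorem sqrt_sub_sqrt_sq_le {a b : ℝ} (ha : 0 ≤ a) (hb : 0 ≤ b) : (√(a + b) - √a) ^ 2 ≤ b := by
  have h1 := Real.sq_sqrt ha
  have h2 := Real.sq_sqrt (add_nonneg ha hb)
  have h3 : √a ≤ √(a + b) := Real.sqrt_le_sqrt (by linarith)
  nlinarith [Real.sqrt_nonneg a]

theorem integrable_sum_comp_eval {ν : Measure ℝ} [IsProbabilityMeasure ν] {Y : ℝ → ℝ}
    (hYi : Integrable Y ν) (n : ℕ) :
    Integrable (fun w : Fin n → ℝ => ∑ i, Y (w i)) (Measure.pi fun _ => ν) :=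
  integrable_finsetSum _ fun _ _ => integrable_comp_eval hYi

theorem integral_sum_comp_eval {ν : Measure ℝ} [IsProbabilityMeasure ν] {Y : ℝ → ℝ}
    (hYi : Integrable Y ν) (n : ℕ) :
    ∫ w, ∑ i, Y (w i) ∂(Measure.pi fun _ : Fin n => ν) = n * ∫ y, Y y ∂ν := by
  rw [integral_finsetSum _ fun _ _ => integrable_comp_eval hYi]
  simp [integral_comp_eval (μ := fun _ : Fin n => ν) hYi.1]

theorem integrable_sqrt_of_nonneg {α : Type*} [MeasurableSpace α] {μ : Measure α}
    [IsFiniteMeasure μ] {f : α → ℝ} (hf : Integrable f μ) (h0 : ∀ x, 0 ≤ f x) :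
    Integrable (fun x => √(f x)) μ := by
  refine (hf.add (integrable_const (1 : ℝ))).mono'
    (Real.continuous_sqrt.comp_aestronglyMeasurable hf.1) (ae_of_all _ fun x => ?_)
  rw [Real.norm_eq_abs, abs_of_nonneg (Real.sqrt_nonneg _), Pi.add_apply]
  nlinarith [Real.sq_sqrt (h0 x), sq_nonneg (√(f x) - 1), Real.sqrt_nonneg (f x)]

theorem integral_pi_succ {ν : Measure ℝ} [IsProbabilityMeasure ν] {n : ℕ}
    (f : (Fin (n + 1) → ℝ) → ℝ) :
    ∫ w, f w ∂(Measure.pi fun _ => ν)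
      = ∫ z, f (Fin.cons z.1 z.2) ∂(ν.prod (Measure.pi fun _ : Fin n => ν)) := by
  have h := (measurePreserving_piFinSuccAbove (fun _ : Fin (n + 1) => ν) 0).symm
  rw [← h.integral_comp (MeasurableEquiv.measurableEmbedding _)]
  simp_rw [MeasurableEquiv.piFinSuccAbove_symm_apply, Fin.insertNthEquiv_zero]
  rfl

/-- An Efron–Stein type bound: if `Y` satisfies a one-dimensional variance bound, then so does
the sum of independent copies of `Y`. -/
theorem variance_sqrt_sum_le {ν : Measure ℝ} [IsProbabilityMeasure ν] {Y : ℝ → ℝ}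
    (hYc : Continuous Y) (hY0 : ∀ y, 0 ≤ Y y) (hYi : Integrable Y ν)
    (hY : ∀ c, 0 < c → ∫ y, (√(c + Y y) - √c) ^ 2 ∂ν ≤ ∫ y, Y y / (c + Y y) ∂ν) (n : ℕ) :
    ∀ c, 0 < c → c + n * ∫ y, Y y ∂ν
        - (∫ w, √(c + ∑ i, Y (w i)) ∂(Measure.pi fun _ : Fin n => ν)) ^ 2
      ≤ ∫ w, (∑ i, Y (w i)) / (c + ∑ i, Y (w i)) ∂(Measure.pi fun _ : Fin n => ν) := by
  induction n with
  | zero =>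
    intro c hc
    simp [Real.sq_sqrt hc.le]
  | succ n ih =>
    intro c hc
    set π := Measure.pi fun _ : Fin n => ν
    set θ := ∫ y, Y y ∂ν
    set S : (Fin n → ℝ) → ℝ := fun w => ∑ i, Y (w i) with hS
    have hS0 : ∀ w, 0 ≤ S w := fun w => Finset.sum_nonneg fun i _ => hY0 _
    have hSi : Integrable S π := integrable_sum_comp_eval hYi n
    have hSθ : ∫ w, S w ∂π = n * θ := integral_sum_comp_eval hYi n
    have hSc : Continuous S := by fun_prop
    have hpos : ∀ z w, 0 < c + Y z + S w := fun z w => by linarith [hY0 z, hS0 w]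
    have hAi : Integrable (fun p : ℝ × (Fin n → ℝ) => √(c + Y p.1 + S p.2)) (ν.prod π) :=
      integrable_sqrt_of_nonneg (((integrable_const c).add (hYi.comp_fst π)).add (hSi.comp_snd ν))
        fun p => (hpos _ _).le
    have hR1 : Integrable (fun p : ℝ × (Fin n → ℝ) => S p.2 / (c + Y p.1 + S p.2)) (ν.prod π) := by
      refine (integrable_const (1 : ℝ)).mono' (Continuous.aestronglyMeasurable
        (Continuous.div (by fun_prop) (by fun_prop) fun p => (hpos _ _).ne'))
        (ae_of_all _ fun p => ?_)
      rw [Real.norm_eq_abs, abs_of_nonneg (div_nonneg (hS0 _) (hpos _ _).le),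
        div_le_one (hpos _ _)]
      linarith [hY0 p.1]
    have hR2 : Integrable (fun p : ℝ × (Fin n → ℝ) => Y p.1 / (c + Y p.1 + S p.2)) (ν.prod π) := by
      refine (integrable_const (1 : ℝ)).mono' (Continuous.aestronglyMeasurable
        (Continuous.div (by fun_prop) (by fun_prop) fun p => (hpos _ _).ne'))
        (ae_of_all _ fun p => ?_)
      rw [Real.norm_eq_abs, abs_of_nonneg (div_nonneg (hY0 _) (hpos _ _).le),
        div_le_one (hpos _ _)]
      linarith [hS0 p.2]
    have hD : Integrable (fun p : ℝ × (Fin n → ℝ) => (√(c + Y p.1 + S p.2) - √(c + S p.2)) ^ 2)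
        (ν.prod π) := by
      refine (hYi.comp_fst π).mono' (Continuous.aestronglyMeasurable (by fun_prop))
        (ae_of_all _ fun p => ?_)
      rw [Real.norm_eq_abs, abs_of_nonneg (sq_nonneg _), add_right_comm]
      exact sqrt_sub_sqrt_sq_le (by linarith [hS0 p.2]) (hY0 _)
    have hAw : ∀ z, Integrable (fun w => √(c + Y z + S w)) π := fun z =>
      integrable_sqrt_of_nonneg ((integrable_const _).add hSi) fun w => (hpos z w).le
    have hBw : Integrable (fun w => √(c + S w)) π :=
      integrable_sqrt_of_nonneg ((integrable_const _).add hSi) fun w => by linarith [hS0 w]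
    set G : ℝ → ℝ := fun z => ∫ w, √(c + Y z + S w) ∂π with hG
    set b : ℝ := ∫ w, √(c + S w) ∂π with hb
    have hGi : Integrable G ν := hAi.integral_prod_left
    have hG2 : Integrable (fun z => G z ^ 2) ν := by
      refine (((integrable_const c).add hYi).add (integrable_const (n * θ))).mono'
        (hGi.1.pow 2) (ae_of_all _ fun z => ?_)
      rw [Real.norm_eq_abs, abs_of_nonneg (sq_nonneg _)]
      have hs : ∀ w, √(c + Y z + S w) ^ 2 = c + Y z + S w := fun w => Real.sq_sqrt (hpos z w).le
      refine (sq_integral_le_integral_sq (hAw z) ?_).trans_eq ?_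
      · simp_rw [hs]; exact (integrable_const _).add hSi
      · simp_rw [hs]
        rw [integral_add (integrable_const _) hSi, hSθ]
        simp
    have h1 : c + θ + n * θ - ∫ z, G z ^ 2 ∂ν
        ≤ ∫ p, S p.2 / (c + Y p.1 + S p.2) ∂(ν.prod π) := by
      rw [integral_prod _ hR1]
      have e : ∫ z, (c + Y z + n * θ - G z ^ 2) ∂ν = c + θ + n * θ - ∫ z, G z ^ 2 ∂ν := by
        have i1 : Integrable (fun z => c + Y z) ν := (integrable_const c).add hYi
        have i2 : Integrable (fun z => c + Y z + n * θ) ν := i1.add (integrable_const _)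
        rw [integral_sub i2 hG2, integral_add i1 (integrable_const _),
          integral_add (integrable_const c) hYi]
        simp [θ]
      rw [← e]
      exact integral_mono ((((integrable_const c).add hYi).add (integrable_const _)).sub hG2)
        hR1.integral_prod_left fun z => ih (c + Y z) (by linarith [hY0 z])
    have h2 : ∫ z, (G z - b) ^ 2 ∂ν ≤ ∫ p, Y p.1 / (c + Y p.1 + S p.2) ∂(ν.prod π) := by
      have s1 : ∫ z, (G z - b) ^ 2 ∂ν
          ≤ ∫ z, ∫ w, (√(c + Y z + S w) - √(c + S w)) ^ 2 ∂π ∂ν := by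
        refine integral_mono_of_nonneg (ae_of_all _ fun _ => sq_nonneg _)
          hD.integral_prod_left (ae_of_all _ fun z => ?_)
        simp only [hG, hb]
        rw [← integral_sub (hAw z) hBw]
        refine sq_integral_le_integral_sq ((hAw z).sub hBw) ?_
        refine (integrable_const (Y z)).mono' (Continuous.aestronglyMeasurable (by fun_prop))
          (ae_of_all _ fun w => ?_)
        rw [Real.norm_eq_abs, abs_of_nonneg (sq_nonneg _), add_right_comm]
        exact sqrt_sub_sqrt_sq_le (by linarith [hS0 w]) (hY0 _)
      refine s1.trans ?_
      rw [← integral_prod _ hD, integral_prod_symm _ hD, integral_prod_symm _ hR2]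
      refine integral_mono hD.integral_prod_right hR2.integral_prod_right fun w => ?_
      have := hY (c + S w) (by linarith [hS0 w])
      simpa only [add_right_comm] using this
    have h3 := integral_sq_sub_sq_integral_le hGi hG2 b
    rw [integral_pi_succ, integral_pi_succ]
    simp only [Fin.sum_univ_succ, Fin.cons_zero, Fin.cons_succ, ← add_assoc]
    have e1 : ∫ p, √(c + Y p.1 + S p.2) ∂(ν.prod π) = ∫ z, G z ∂ν := integral_prod _ hAi
    have e2 : ∫ p, (Y p.1 + S p.2) / (c + Y p.1 + S p.2) ∂(ν.prod π)
        = ∫ p, S p.2 / (c + Y p.1 + S p.2) ∂(ν.prod π)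
          + ∫ p, Y p.1 / (c + Y p.1 + S p.2) ∂(ν.prod π) := by
      rw [← integral_add hR1 hR2]
      congr 1 with p
      ring
    simp only [hS] at e1 e2 h1 h2
    rw [e1, e2]
    push_cast
    linarith

theorem integral_sum_sub_one_le_sq_integral_sqrt {ν : Measure ℝ} [IsProbabilityMeasure ν]
    {Y : ℝ → ℝ} (hYc : Continuous Y) (hY0 : ∀ y, 0 ≤ Y y) (hYi : Integrable Y ν)
    (hY : ∀ c, 0 < c → ∫ y, (√(c + Y y) - √c) ^ 2 ∂ν ≤ ∫ y, Y y / (c + Y y) ∂ν) (n : ℕ) :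
    n * ∫ y, Y y ∂ν - 1 ≤ (∫ w, √(∑ i, Y (w i)) ∂(Measure.pi fun _ : Fin n => ν)) ^ 2 := by
  have hS0 : ∀ w : Fin n → ℝ, 0 ≤ ∑ i, Y (w i) := fun w => Finset.sum_nonneg fun i _ => hY0 _
  have hSi := integrable_sum_comp_eval hYi n
  have hI : Integrable (fun w : Fin n → ℝ => √(∑ i, Y (w i))) (Measure.pi fun _ => ν) :=
    integrable_sqrt_of_nonneg hSi hS0
  set E := ∫ w, √(∑ i, Y (w i)) ∂(Measure.pi fun _ : Fin n => ν) with hE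
  have key : ∀ e : ℝ, 0 < e → n * ∫ y, Y y ∂ν - 1 ≤ (e + E) ^ 2 := by
    intro e he
    have h := variance_sqrt_sum_le hYc hY0 hYi hY n (e ^ 2) (by positivity)
    have h1 : ∫ w, (∑ i, Y (w i)) / (e ^ 2 + ∑ i, Y (w i)) ∂(Measure.pi fun _ : Fin n => ν) ≤ 1 := by
      have := integral_mono_of_nonneg (μ := Measure.pi fun _ : Fin n => ν)
        (f := fun w => (∑ i, Y (w i)) / (e ^ 2 + ∑ i, Y (w i))) (g := fun _ => (1 : ℝ))
        (ae_of_all _ fun w => div_nonneg (hS0 w) (add_nonneg (sq_nonneg e) (hS0 w)))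
        (integrable_const _)
        (ae_of_all _ fun w => div_le_one_of_le₀ (by linarith [sq_nonneg e])
          (add_nonneg (sq_nonneg e) (hS0 w)))
      simpa using this
    have h2 : ∫ w, √(e ^ 2 + ∑ i, Y (w i)) ∂(Measure.pi fun _ : Fin n => ν) ≤ e + E := by
      have : e + E = ∫ w, (e + √(∑ i, Y (w i))) ∂(Measure.pi fun _ : Fin n => ν) := by
        rw [integral_add (integrable_const _) hI]
        simp [hE]
      rw [this]
      refine integral_mono_of_nonneg (ae_of_all _ fun _ => Real.sqrt_nonneg _)
        ((integrable_const _).add hI) (ae_of_all _ fun w => ?_)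
      refine Real.sqrt_le_iff.2 ⟨by positivity, ?_⟩
      nlinarith [Real.sq_sqrt (hS0 w), Real.sqrt_nonneg (∑ i, Y (w i))]
    have h3 : 0 ≤ ∫ w, √(e ^ 2 + ∑ i, Y (w i)) ∂(Measure.pi fun _ : Fin n => ν) :=
      integral_nonneg fun _ => Real.sqrt_nonneg _
    nlinarith [sq_nonneg e]
  have hlim : Tendsto (fun e : ℝ => (e + E) ^ 2) (nhdsWithin 0 (Set.Ioi 0)) (nhds (E ^ 2)) := by
    have : Continuous fun e : ℝ => (e + E) ^ 2 := by fun_prop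
    simpa using (this.tendsto 0).mono_left nhdsWithin_le_nhds
  exact ge_of_tendsto hlim (eventually_mem_nhdsWithin.mono fun e he => key e he)

instance isProbabilityMeasure_stdGaussian (n : ℕ) : IsProbabilityMeasure (_root_.stdGaussian n) := by
  unfold _root_.stdGaussian
  infer_instance

theorem integrable_max_abs_sub_sq {t : ℝ} (ht : 0 ≤ t) :
    Integrable (fun x => max (|x| - t) 0 ^ 2) (gaussianReal 0 1) := by
  refine integrable_sq_gaussianReal.mono' (by fun_prop) (ae_of_all _ fun x => ?_)
  rw [Real.norm_eq_abs, abs_of_nonneg (sq_nonneg _), ← sq_abs x]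
  exact pow_le_pow_left₀ (le_max_right _ _) (max_le (by linarith) (abs_nonneg x)) 2

theorem thetaFun_zero : thetaFun 0 = 1 := by
  have h := variance_fun_id_gaussianReal (μ := 0) (v := 1)
  rw [variance_of_integral_eq_zero (by fun_prop) integral_id_gaussianReal] at h
  simpa [thetaFun] using h

theorem strictAntiOn_thetaFun : StrictAntiOn thetaFun (Set.Ici 0) := by
  intro s hs t ht hst
  have hs' : 0 ≤ s := hs
  have ht' : 0 ≤ t := ht
  have : (gaussianReal 0 1).IsOpenPosMeasure :=
    (gaussianReal_absolutelyContinuous' 0 one_ne_zero).isOpenPosMeasure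
  rw [← sub_pos, thetaFun, thetaFun,
    ← integral_sub (integrable_max_abs_sub_sq hs) (integrable_max_abs_sub_sq ht)]
  refine integral_pos_of_integrable_nonneg_nonzero (x := t) (by fun_prop)
    ((integrable_max_abs_sub_sq hs).sub (integrable_max_abs_sub_sq ht)) (fun x => ?_) ?_
  · exact sub_nonneg.2 (pow_le_pow_left₀ (le_max_right _ _)
      (max_le_max (by linarith) le_rfl) 2)
  · rw [abs_of_nonneg ht', sub_self, max_self, max_eq_left (by linarith)]
    have : 0 < t - s := by linarith
    rw [zero_pow two_ne_zero, sub_zero]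
    positivity

theorem l2norm_eq_norm {n : ℕ} (x : Fin n → ℝ) : l2norm x = ‖WithLp.toLp 2 x‖ := by
  simp [l2norm, EuclideanSpace.norm_eq]

theorem distL2_eq_infDist {n : ℕ} (C : Set (Fin n → ℝ)) (h : Fin n → ℝ) :
    distL2 C h = Metric.infDist (WithLp.toLp 2 h) (WithLp.toLp 2 '' C) := by
  rw [distL2, Metric.infDist_eq_iInf, ← sInf_image', Set.image_image]
  simp only [l2norm_eq_norm, dist_eq_norm, WithLp.toLp_sub]

theorem lqNorm_eq_norm {n : ℕ} {q : ℝ≥0∞} (hq : 1 ≤ q) (x : Fin n → ℝ) :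
    lqNorm q x = ‖WithLp.toLp q x‖ := by
  by_cases h : q = ⊤
  · subst h
    simp [lqNorm, PiLp.norm_eq_ciSup]
  · have h0 : 0 < q.toReal := ENNReal.toReal_pos (zero_lt_one.trans_le hq).ne' h
    simp [lqNorm, h, PiLp.norm_eq_sum h0]

theorem abs_le_lqNorm {n : ℕ} {q : ℝ≥0∞} (hq : 1 ≤ q) (x : Fin n → ℝ) (i : Fin n) :
    |x i| ≤ lqNorm q x := by
  have : Fact (1 ≤ q) := ⟨hq⟩
  rw [lqNorm_eq_norm hq]
  exact PiLp.norm_apply_le (WithLp.toLp q x) i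

theorem lqNorm_le_mul_rpow {n : ℕ} {q : ℝ≥0∞} (hq : 1 ≤ q) {r : ℝ} (hr : 0 ≤ r)
    {x : Fin n → ℝ} (hx : ∀ i, |x i| ≤ r) : lqNorm q x ≤ r * (n : ℝ) ^ (1 / q).toReal := by
  by_cases h : q = ⊤
  · subst h
    simpa [lqNorm] using Real.iSup_le hx hr
  · have h0 : 0 < q.toReal := ENNReal.toReal_pos (zero_lt_one.trans_le hq).ne' h
    rw [lqNorm, if_neg h, one_div, one_div, ENNReal.toReal_inv]
    have hs : ∑ i, |x i| ^ q.toReal ≤ n * r ^ q.toReal := by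
      refine (Finset.sum_le_sum fun i _ =>
        Real.rpow_le_rpow (abs_nonneg _) (hx i) h0.le).trans_eq ?_
      simp
    refine (Real.rpow_le_rpow (Finset.sum_nonneg fun i _ => by positivity) hs
      (by positivity)).trans_eq ?_
    rw [Real.mul_rpow (by positivity) (by positivity), Real.rpow_rpow_inv hr h0.ne', mul_comm]

theorem lqNorm_combo_le {n : ℕ} {q : ℝ≥0∞} (hq : 1 ≤ q) {a b s t : ℝ} (ha : 0 ≤ a) (hb : 0 ≤ b)
    {x y : Fin n → ℝ} (hx : lqNorm q x ≤ s) (hy : lqNorm q y ≤ t) :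
    lqNorm q (a • x + b • y) ≤ a * s + b * t := by
  have : Fact (1 ≤ q) := ⟨hq⟩
  rw [lqNorm_eq_norm hq] at *
  rw [WithLp.toLp_add, WithLp.toLp_smul, WithLp.toLp_smul]
  refine (norm_add_le _ _).trans ?_
  rw [norm_smul, norm_smul, Real.norm_of_nonneg ha, Real.norm_of_nonneg hb]
  gcongr

theorem zero_mem_lqBall {n : ℕ} {q : ℝ≥0∞} (hq : 1 ≤ q) {t : ℝ} (ht : 0 ≤ t) :
    (0 : Fin n → ℝ) ∈ {x | lqNorm q x ≤ t} := by
  have : Fact (1 ≤ q) := ⟨hq⟩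
  rw [Set.mem_ofPred_eq, lqNorm_eq_norm hq]
  simpa using ht

theorem distL2_le_of_mem {n : ℕ} {C : Set (Fin n → ℝ)} {w : Fin n → ℝ} (hw : w ∈ C)
    (h : Fin n → ℝ) : distL2 C h ≤ l2norm (h - w) := by
  rw [distL2_eq_infDist, l2norm_eq_norm, WithLp.toLp_sub, ← dist_eq_norm]
  exact Metric.infDist_le_dist_of_mem (Set.mem_image_of_mem _ hw)

theorem distL2_nonneg {n : ℕ} (C : Set (Fin n → ℝ)) (h : Fin n → ℝ) : 0 ≤ distL2 C h := by
  rw [distL2_eq_infDist]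
  exact Metric.infDist_nonneg

theorem integrable_l2norm (n : ℕ) : Integrable l2norm (_root_.stdGaussian n) :=
  integrable_sqrt_of_nonneg (integrable_sum_comp_eval integrable_sq_gaussianReal n)
    fun _ => Finset.sum_nonneg fun _ _ => sq_nonneg _

theorem integrable_distL2 {n : ℕ} {C : Set (Fin n → ℝ)} (hC : 0 ∈ C) :
    Integrable (distL2 C) (_root_.stdGaussian n) := by
  refine (integrable_l2norm n).mono' ?_ (ae_of_all _ fun h => ?_)
  · have : distL2 C = fun h => Metric.infDist (WithLp.toLp 2 h) (WithLp.toLp 2 '' C) :=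
      funext (distL2_eq_infDist C)
    rw [this]
    exact ((Metric.continuous_infDist_pt _).comp
      (PiLp.continuous_toLp 2 fun _ : Fin n => ℝ)).aestronglyMeasurable
  · rw [Real.norm_of_nonneg (distL2_nonneg C h)]
    simpa using distL2_le_of_mem hC h

theorem distL2_lqBall_convexOn {n : ℕ} {q : ℝ≥0∞} (hq : 1 ≤ q) (h : Fin n → ℝ) :
    ConvexOn ℝ (Set.Ici 0) fun t => distL2 {x | lqNorm q x ≤ t} h := by
  refine ⟨convex_Ici 0, fun s hs t ht a b ha hb hab => ?_⟩
  refine le_of_forall_pos_le_add fun e he => ?_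
  have hex : ∀ r, 0 ≤ r → ∃ w : Fin n → ℝ, lqNorm q w ≤ r ∧
      l2norm (h - w) < distL2 {x | lqNorm q x ≤ r} h + e := fun r hr => by
    have := (Metric.infDist_lt_iff (s := WithLp.toLp 2 '' {x : Fin n → ℝ | lqNorm q x ≤ r})
      (x := WithLp.toLp 2 h) ⟨_, Set.mem_image_of_mem _ (zero_mem_lqBall hq hr)⟩).1
      (lt_add_of_pos_right _ he)
    obtain ⟨_, ⟨w, hw, rfl⟩, hlt⟩ := this
    refine ⟨w, hw, ?_⟩
    rwa [distL2_eq_infDist, l2norm_eq_norm, WithLp.toLp_sub, ← dist_eq_norm]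
  obtain ⟨w₁, hw₁, h₁⟩ := hex s hs
  obtain ⟨w₂, hw₂, h₂⟩ := hex t ht
  simp only [smul_eq_mul]
  have hm : distL2 {x | lqNorm q x ≤ a * s + b * t} h ≤ l2norm (h - (a • w₁ + b • w₂)) :=
    distL2_le_of_mem (lqNorm_combo_le hq ha hb hw₁ hw₂) h
  have ht : l2norm (h - (a • w₁ + b • w₂)) ≤ a * l2norm (h - w₁) + b * l2norm (h - w₂) := by
    have : h - (a • w₁ + b • w₂) = a • (h - w₁) + b • (h - w₂) := by
      have : h = (a + b) • h := by rw [hab, one_smul]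
      nth_rewrite 1 [this]
      module
    rw [this]
    simp only [l2norm_eq_norm]
    rw [WithLp.toLp_add, WithLp.toLp_smul, WithLp.toLp_smul]
    refine (norm_add_le _ _).trans_eq ?_
    rw [norm_smul, norm_smul, Real.norm_of_nonneg ha, Real.norm_of_nonneg hb]
  have := mul_le_mul_of_nonneg_left h₁.le ha
  have := mul_le_mul_of_nonneg_left h₂.le hb
  have : a * e + b * e = e := by rw [← add_mul, hab, one_mul]
  linarith

theorem distL2_lqBall_antitoneOn {n : ℕ} {q : ℝ≥0∞} (hq : 1 ≤ q) (h : Fin n → ℝ) :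
    AntitoneOn (fun t => distL2 {x | lqNorm q x ≤ t} h) (Set.Ici 0) := by
  intro s hs t ht hst
  simp only [distL2_eq_infDist]
  exact Metric.infDist_le_infDist_of_subset
    (Set.image_mono fun x (hx : lqNorm q x ≤ s) => hx.trans hst)
    ⟨_, Set.mem_image_of_mem _ (zero_mem_lqBall hq hs)⟩

theorem Dp_convexOn {q : ℝ≥0∞} (hq : 1 ≤ q) (n : ℕ) : ConvexOn ℝ (Set.Ici 0) (Dp q n) := by
  have hi : ∀ t ∈ Set.Ici (0 : ℝ), Integrable (distL2 {x : Fin n → ℝ | lqNorm q x ≤ t})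
      (_root_.stdGaussian n) := fun t ht => integrable_distL2 (zero_mem_lqBall hq ht)
  have hf : ConvexOn ℝ (Set.Ici 0) fun t =>
      ∫ h, distL2 {x | lqNorm q x ≤ t} h ∂_root_.stdGaussian n := by
    refine ⟨convex_Ici 0, fun s hs t ht a b ha hb hab => ?_⟩
    have hst := convex_Ici (0 : ℝ) hs ht ha hb hab
    simp only [smul_eq_mul] at hst ⊢
    rw [← integral_const_mul, ← integral_const_mul,
      ← integral_add ((hi s hs).const_mul a) ((hi t ht).const_mul b)]
    exact integral_mono (hi _ hst) (((hi s hs).const_mul a).add ((hi t ht).const_mul b))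
      fun h => (distL2_lqBall_convexOn hq h).2 hs ht ha hb hab
  exact (hf.pow (fun t _ => integral_nonneg fun h => distL2_nonneg _ h) 2).smul
    (c := (1 / n : ℝ)) (by positivity)

theorem Dp_antitoneOn {q : ℝ≥0∞} (hq : 1 ≤ q) (n : ℕ) : AntitoneOn (Dp q n) (Set.Ici 0) := by
  intro s hs t ht hst
  refine mul_le_mul_of_nonneg_left (pow_le_pow_left₀
    (integral_nonneg fun h => distL2_nonneg _ h) ?_ 2) (by positivity)
  exact integral_mono (integrable_distL2 (zero_mem_lqBall hq ht))
    (integrable_distL2 (zero_mem_lqBall hq hs)) fun h => distL2_lqBall_antitoneOn hq h hs ht hst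

theorem deriv_Dp_nonpos {q : ℝ≥0∞} (hq : 1 ≤ q) (n : ℕ) {t : ℝ} (ht : 0 < t) :
    deriv (Dp q n) t ≤ 0 := by
  rw [← derivWithin_of_isOpen isOpen_Ioi (Set.mem_Ioi.2 ht)]
  exact ((Dp_antitoneOn hq n).mono Set.Ioi_subset_Ici_self).derivWithin_nonpos

theorem Dp_sub_mul_deriv_le {q : ℝ≥0∞} (hq : 1 ≤ q) (n : ℕ) {t : ℝ} (ht : 0 < t) :
    Dp q n t - t / 2 * deriv (Dp q n) t ≤ Dp q n (t / 2) := by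
  have h0 : (0 : ℝ) ≤ t / 2 := by positivity
  by_cases hd : DifferentiableAt ℝ (Dp q n) t
  · have := (Dp_convexOn hq n).slope_le_deriv h0 ht.le (half_lt_self ht) hd
    rw [slope_def_field, div_le_iff₀ (by linarith)] at this
    linarith
  · rw [deriv_zero_of_not_differentiableAt hd]
    have := Dp_antitoneOn hq n h0 ht.le (half_le_self ht.le)
    linarith

theorem Dp_le_thetaFun {q : ℝ≥0∞} (hq : 1 ≤ q) {n : ℕ} (hn : 0 < n) {r : ℝ} (hr : 0 ≤ r) :
    Dp q n (r * (n : ℝ) ^ (1 / q).toReal) ≤ thetaFun r := by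
  have hn' : (0 : ℝ) < n := Nat.cast_pos.2 hn
  set t := r * (n : ℝ) ^ (1 / q).toReal with ht
  have ht0 : 0 ≤ t := by positivity
  have hSi : Integrable (fun h : Fin n → ℝ => ∑ i, max (|h i| - r) 0 ^ 2) (_root_.stdGaussian n) :=
    integrable_sum_comp_eval (integrable_max_abs_sub_sq hr) n
  have hS0 : ∀ h : Fin n → ℝ, 0 ≤ ∑ i, max (|h i| - r) 0 ^ 2 := fun h =>
    Finset.sum_nonneg fun i _ => sq_nonneg _
  have hle : ∀ h, distL2 {x : Fin n → ℝ | lqNorm q x ≤ t} h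
      ≤ √(∑ i, max (|h i| - r) 0 ^ 2) := by
    intro h
    refine (distL2_le_of_mem (w := fun i => max (-r) (min r (h i)))
      (lqNorm_le_mul_rpow hq hr fun i => ?_) h).trans_eq ?_
    · exact abs_le.2 ⟨le_max_left _ _, max_le (by linarith) (min_le_left _ _)⟩
    · rw [l2norm]
      congr 1
      refine Finset.sum_congr rfl fun i _ => ?_
      rw [Pi.sub_apply, max_abs_sub_sq' hr]
      congr 1
      rcases le_total r (h i) with h1 | h1
      · rw [min_eq_left h1, max_eq_right (by linarith), max_eq_left (by linarith),
          max_eq_right (by linarith), sub_zero]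
      · rw [min_eq_right h1, max_eq_right (show h i - r ≤ 0 by linarith)]
        rcases le_total (-r) (h i) with h2 | h2
        · rw [max_eq_right h2, max_eq_right (by linarith)]; ring
        · rw [max_eq_left h2, max_eq_left (by linarith)]; ring
  have hsq : ∀ h : Fin n → ℝ, √(∑ i, max (|h i| - r) 0 ^ 2) ^ 2 = ∑ i, max (|h i| - r) 0 ^ 2 :=
    fun h => Real.sq_sqrt (hS0 h)
  have hI := integrable_sqrt_of_nonneg hSi hS0
  have h1 : (∫ h, distL2 {x | lqNorm q x ≤ t} h ∂_root_.stdGaussian n) ^ 2 ≤ n * thetaFun r := by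
    calc _ ≤ (∫ h, √(∑ i, max (|h i| - r) 0 ^ 2) ∂_root_.stdGaussian n) ^ 2 :=
          pow_le_pow_left₀ (integral_nonneg fun h => distL2_nonneg _ h)
            (integral_mono (integrable_distL2 (zero_mem_lqBall hq ht0)) hI hle) 2
      _ ≤ ∫ h, √(∑ i, max (|h i| - r) 0 ^ 2) ^ 2 ∂_root_.stdGaussian n :=
          sq_integral_le_integral_sq hI (by simpa only [hsq] using hSi)
      _ = n * thetaFun r := by
          simp only [hsq]
          exact integral_sum_comp_eval (integrable_max_abs_sub_sq hr) n
  rw [Dp, one_div, inv_mul_le_iff₀ hn']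
  exact h1

theorem thetaFun_sub_le_Dp {q : ℝ≥0∞} (hq : 1 ≤ q) {n : ℕ} (hn : 0 < n) {t : ℝ} (ht : 0 ≤ t) :
    thetaFun t - 1 / n ≤ Dp q n t := by
  have hn' : (0 : ℝ) < n := Nat.cast_pos.2 hn
  have hle : ∀ h, √(∑ i, max (|h i| - t) 0 ^ 2)
      ≤ distL2 {x : Fin n → ℝ | lqNorm q x ≤ t} h := by
    intro h
    refine le_csInf ((Set.nonempty_of_mem (zero_mem_lqBall hq ht)).image _) ?_
    rintro _ ⟨w, hw, rfl⟩
    refine Real.sqrt_le_sqrt (Finset.sum_le_sum fun i _ => ?_)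
    rw [← sq_abs ((h - w) i)]
    refine pow_le_pow_left₀ (le_max_right _ _) (max_le ?_ (abs_nonneg _)) 2
    have h1 : |w i| ≤ t := (abs_le_lqNorm hq w i).trans hw
    have h2 := abs_sub_abs_le_abs_sub (h i) (w i)
    rw [Pi.sub_apply]
    linarith
  have h1 := integral_sum_sub_one_le_sq_integral_sqrt (ν := gaussianReal 0 1)
    (Y := fun x => max (|x| - t) 0 ^ 2) (by fun_prop) (fun _ => sq_nonneg _)
    (integrable_max_abs_sub_sq ht) (fun c hc => integral_sqrt_add_sub_sq_le ht hc) n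
  have h2 : ∫ h, √(∑ i, max (|h i| - t) 0 ^ 2) ∂_root_.stdGaussian n
      ≤ ∫ h, distL2 {x | lqNorm q x ≤ t} h ∂_root_.stdGaussian n :=
    integral_mono_of_nonneg (ae_of_all _ fun _ => Real.sqrt_nonneg _)
      (integrable_distL2 (zero_mem_lqBall hq ht)) (ae_of_all _ hle)
  have h3 := h1.trans (pow_le_pow_left₀ (integral_nonneg fun _ => Real.sqrt_nonneg _) h2 2)
  rw [Dp, ← mul_le_mul_iff_right₀ hn']
  field_simp
  exact h3

/-- Bounds on `t*_p(δ; n)`, the unique positive solution of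
`δ = D_p(t) − (t/2) D_p'(t)`: (i) `t* ≤ 2 θ⁻¹(δ) n^{1 − 1/p}` for any `n ≥ 1`, and
(ii) `t* ≥ θ⁻¹((1+δ)/2) > 0` whenever `n ≥ 2/(1−δ)`. Here `q = p*` is the Hölder
conjugate of `p`, `u = θ⁻¹(δ)` and `v = θ⁻¹((1+δ)/2)`. -/
theorem tstar_bounds (m n : ℕ) (hm : 1 ≤ m) (hmn : m < n)
    (p q : ℝ≥0∞) (hp : 1 ≤ p) (hpq : 1 / p + 1 / q = 1)
    (δ : ℝ) (hδ0 : 0 < δ) (hδ1 : δ < 1) (hδ : δ = ((m : ℝ) - 1) / n)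
    (tstar : ℝ) (htpos : 0 < tstar)
    (hteq : δ = Dp q n tstar - (tstar / 2) * deriv (Dp q n) tstar)
    (htuniq : ∀ s : ℝ, 0 < s →
      δ = Dp q n s - (s / 2) * deriv (Dp q n) s → s = tstar)
    (u : ℝ) (hu0 : 0 ≤ u) (hu : thetaFun u = δ)
    (v : ℝ) (hv0 : 0 ≤ v) (hv : thetaFun v = (1 + δ) / 2) :
    tstar ≤ 2 * u * (n : ℝ) ^ (1 - (1 / p).toReal) ∧
    (2 / (1 - δ) ≤ (n : ℝ) → 0 < v ∧ v ≤ tstar) := by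
  have hn : 0 < n := by omega
  have hn' : (0 : ℝ) < n := Nat.cast_pos.2 hn
  have hq : 1 ≤ q := by
    have h : 1 / q ≤ 1 := le_add_self.trans_eq hpq
    rwa [one_div, ENNReal.inv_le_one] at h
  have hexp : 1 - (1 / p).toReal = (1 / q).toReal := by
    have hp1 : 1 / p ≠ ⊤ := fun h => by simp [h] at hpq
    have hq1 : 1 / q ≠ ⊤ := fun h => by simp [h] at hpq
    have := congrArg ENNReal.toReal hpq
    rw [ENNReal.toReal_add hp1 hq1, ENNReal.toReal_one] at this
    linarith
  rw [hexp]
  refine ⟨?_, fun hnδ => ⟨?_, ?_⟩⟩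
  · have hN : 0 < (n : ℝ) ^ (1 / q).toReal := by positivity
    set r := tstar / 2 / (n : ℝ) ^ (1 / q).toReal with hr
    have hr0 : 0 ≤ r := by positivity
    have hrN : r * (n : ℝ) ^ (1 / q).toReal = tstar / 2 := div_mul_cancel₀ _ hN.ne'
    have h1 := Dp_le_thetaFun hq hn hr0
    rw [hrN] at h1
    have h2 := (hteq.le.trans (Dp_sub_mul_deriv_le hq n htpos)).trans h1
    rw [← hu, strictAntiOn_thetaFun.le_iff_ge hu0 hr0] at h2
    nlinarith
  · refine hv0.lt_of_ne fun h => ?_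
    rw [← h, thetaFun_zero] at hv
    linarith
  · have h1 := thetaFun_sub_le_Dp hq hn htpos.le
    have h2 := mul_nonpos_of_nonneg_of_nonpos (half_pos htpos).le (deriv_Dp_nonpos hq n htpos)
    have h3 : 1 / (n : ℝ) ≤ (1 - δ) / 2 := by
      rw [div_le_iff₀ (by linarith)] at hnδ
      rw [div_le_div_iff₀ hn' two_pos]
      linarith
    refine (strictAntiOn_thetaFun.le_iff_ge htpos.le hv0).1 ?_
    rw [hv]
    linarith
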